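/- For all integers 2 < s ≤ t and 3 ≤ j ≤ (2/3)(s+t) − 5/3, wsat(s+t+j, K_{s,t}) ≥ C(s+t+j, 2) − (19/12)(j+1)(s+t−1). -/

import Mathlib

open SimpleGraph

/-- `G` contains a copy of `F`. -/
def ContainsCopy {W V : Type*} (F : SimpleGraph W) (G : SimpleGraph V) : Prop :=
  ∃ f : W ↪ V, ∀ a b, F.Adj a b → G.Adj (f a) (f b)

/-- One step of the weak saturation process: add one missing edge `e` so that the new
graph contains a copy of `F` through `e`. -/
def AddStep {W V : Type*} (F : SimpleGraph W) (G G' : SimpleGraph V) : Prop :=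
  ∃ e, e ∉ G.edgeSet ∧ G'.edgeSet = insert e G.edgeSet ∧
    ∃ f : W ↪ V, (∀ a b, F.Adj a b → G'.Adj (f a) (f b)) ∧
      ∃ a b, F.Adj a b ∧ s(f a, f b) = e

/-- `G` is weakly `F`-saturated. -/
def IsWeaklySaturated {W V : Type*} (F : SimpleGraph W) (G : SimpleGraph V) : Prop :=
  ¬ ContainsCopy F G ∧
  ∃ (m : ℕ) (c : ℕ → SimpleGraph V), c 0 = G ∧ c m = ⊤ ∧
    ∀ i < m, AddStep F (c i) (c (i + 1))

/-- The weak saturation number `wsat(n, F)`. -/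
noncomputable def wsat {W : Type*} (n : ℕ) (F : SimpleGraph W) : ℕ :=
  sInf {m | ∃ G : SimpleGraph (Fin n), IsWeaklySaturated F G ∧ G.edgeSet.ncard = m}

section BK
set_option linter.unusedSectionVars false
open Classical in
/-- Number of ordered adjacent pairs from `X` to `Y`. -/
noncomputable def cc {V : Type*} (H : SimpleGraph V) (X Y : Finset V) : ℚ :=
  ∑ u ∈ X, ∑ v ∈ Y, if H.Adj u v then (1 : ℚ) else 0

variable {V : Type*} [DecidableEq V] (H : SimpleGraph V)

open Classical in
lemma cc_comm (X Y : Finset V) : cc H X Y = cc H Y X := by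
  unfold cc
  rw [Finset.sum_comm]
  refine Finset.sum_congr rfl fun u _ => Finset.sum_congr rfl fun v _ => ?_
  by_cases h : H.Adj u v
  · simp [h, h.symm]
  · have h2 : ¬ H.Adj v u := fun hh => h hh.symm
    simp [h, h2]

lemma cc_nonneg (X Y : Finset V) : 0 ≤ cc H X Y := by
  unfold cc
  refine Finset.sum_nonneg fun u _ => Finset.sum_nonneg fun v _ => ?_
  split_ifs <;> norm_num

lemma cc_le (X Y : Finset V) : cc H X Y ≤ (X.card : ℚ) * Y.card := by
  unfold cc
  calc _ ≤ ∑ u ∈ X, ∑ v ∈ Y, (1 : ℚ) := by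
        refine Finset.sum_le_sum fun u _ => Finset.sum_le_sum fun v _ => ?_
        split_ifs <;> norm_num
    _ = _ := by simp

lemma cc_self_le (X : Finset V) : cc H X X ≤ (X.card : ℚ) * (X.card - 1) := by
  unfold cc
  calc _ ≤ ∑ u ∈ X, ∑ v ∈ X, ((1 : ℚ) - if u = v then 1 else 0) := by
        refine Finset.sum_le_sum fun u _ => Finset.sum_le_sum fun v _ => ?_
        by_cases h : u = v
        · subst h; simp
        · simp only [h, if_false]; split_ifs <;> norm_num
    _ = _ := by
        simp [Finset.sum_sub_distrib]; ring

lemma cc_zero (X Y : Finset V) (h : ∀ u ∈ X, ∀ v ∈ Y, ¬ H.Adj u v) : cc H X Y = 0 := by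
  unfold cc
  refine Finset.sum_eq_zero fun u hu => Finset.sum_eq_zero fun v hv => ?_
  simp [h u hu v hv]

lemma cc_union_left (X Y Z : Finset V) (h : Disjoint X Y) :
    cc H (X ∪ Y) Z = cc H X Z + cc H Y Z := by
  unfold cc
  rw [Finset.sum_union h]

lemma cc_union_right (X Y Z : Finset V) (h : Disjoint X Y) :
    cc H Z (X ∪ Y) = cc H Z X + cc H Z Y := by
  rw [cc_comm, cc_union_left H X Y Z h, cc_comm H X, cc_comm H Y]

/-- `(A, S, B)` is a separation of `W` of order exactly `k`. -/
structure IsSep (k : ℕ) (W A S B : Finset V) : Prop where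
  un : A ∪ S ∪ B = W
  dAS : Disjoint A S
  dAB : Disjoint A B
  dSB : Disjoint S B
  cS : S.card = k
  nA : A.Nonempty
  nB : B.Nonempty
  no : ∀ u ∈ A, ∀ v ∈ B, ¬ H.Adj u v

variable {H} in
lemma IsSep.symm {k : ℕ} {W A S B : Finset V} (h : IsSep H k W A S B) : IsSep H k W B S A where
  un := by rw [← h.un]; ext; simp; tauto
  dAS := h.dSB.symm
  dAB := h.dAB.symm
  dSB := h.dAS.symm
  cS := h.cS
  nA := h.nB
  nB := h.nA
  no := fun u hu v hv hh => h.no v hv u hu hh.symm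

variable {H} in
lemma IsSep.card {k : ℕ} {W A S B : Finset V} (h : IsSep H k W A S B) :
    W.card = A.card + k + B.card := by
  rw [← h.un, Finset.card_union_of_disjoint, Finset.card_union_of_disjoint h.dAS, h.cS]
  rw [Finset.disjoint_union_left]; exact ⟨h.dAB, h.dSB⟩

variable {H} in
lemma IsSep.cc_eq {k : ℕ} {W A S B : Finset V} (h : IsSep H k W A S B) :
    cc H W W = cc H (B ∪ S) (B ∪ S) + 2 * cc H A S + cc H A A := by
  have hd : Disjoint A (B ∪ S) := by
    rw [Finset.disjoint_union_right]; exact ⟨h.dAB, h.dAS⟩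
  have e : W = A ∪ (B ∪ S) := by rw [← h.un]; ext; simp; tauto
  rw [e, cc_union_left _ _ _ _ hd, cc_union_right _ _ _ _ hd, cc_union_right _ _ _ _ hd,
    cc_comm H (B ∪ S) A, cc_union_right _ _ _ A h.dSB.symm, cc_zero H A B h.no]
  ring

lemma matula (k : ℕ) (hsep : ∀ W : Finset V, k + 2 ≤ W.card → ∃ A S B, IsSep H k W A S B) :
    ∀ d : ℕ, 1 ≤ d → ∀ W : Finset V, W.card = k + d →
      cc H W W ≤ ((k : ℚ) + d) * (k + d - 1) - 2 * ((d : ℚ) ^ 2 - 1) / 3 := by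
  intro d
  induction d using Nat.strong_induction_on with
  | _ d ih =>
  intro hd W hW
  rcases Nat.lt_or_ge d 2 with h2 | h2
  · obtain rfl : d = 1 := by omega
    have := cc_self_le H W
    rw [hW] at this
    push_cast at this ⊢
    linarith
  obtain ⟨A, S, B, h, hab⟩ : ∃ A S B, IsSep H k W A S B ∧ A.card ≤ B.card := by
    obtain ⟨A, S, B, h⟩ := hsep W (by omega)
    rcases le_total A.card B.card with h' | h'
    · exact ⟨A, S, B, h, h'⟩
    · exact ⟨B, S, A, h.symm, h'⟩
  have hc := h.card
  have hA := h.nA.card_pos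
  have hB := h.nB.card_pos
  have i := ih B.card (by omega) hB (B ∪ S) (by
    rw [Finset.card_union_of_disjoint h.dSB.symm, h.cS]; omega)
  have h1 := cc_le H A S
  have h2 := cc_self_le H A
  rw [h.cS] at h1
  rw [h.cc_eq]
  have e : (d : ℚ) = A.card + B.card := by
    have : d = A.card + B.card := by omega
    rw [this]; push_cast; ring
  have hab' : (A.card : ℚ) ≤ B.card := by exact_mod_cast hab
  have hA' : (1 : ℚ) ≤ A.card := by exact_mod_cast hA
  rw [e]
  nlinarith


lemma del_bound (W D N : Finset V) (hD : D ⊆ W)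
    (hno : ∀ u ∈ D, ∀ v ∈ (W \ D) \ N, ¬ H.Adj u v) :
    cc H W W ≤ cc H (W \ D) (W \ D) + 2 * ((D.card : ℚ) * N.card) + D.card * ((D.card : ℚ) - 1) := by
  have hd : Disjoint D (W \ D) := Finset.disjoint_sdiff
  have e : W = D ∪ (W \ D) := by rw [Finset.union_sdiff_of_subset hD]
  have e1 : cc H W W = cc H (W \ D) (W \ D) + 2 * cc H D (W \ D) + cc H D D := by
    conv_lhs => rw [e]
    rw [cc_union_left _ _ _ _ hd, cc_union_right _ _ _ _ hd, cc_union_right _ _ _ _ hd,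
      cc_comm H (W \ D) D]
    ring
  have e2 : cc H D (W \ D) = cc H D ((W \ D) \ N) + cc H D ((W \ D) ∩ N) := by
    rw [← cc_union_right _ _ _ _ (Finset.disjoint_sdiff_inter _ _), Finset.sdiff_union_inter]
  rw [cc_zero H _ _ hno] at e2
  have h1 := cc_le H D ((W \ D) ∩ N)
  have h2 := cc_self_le H D
  have h3 : (((W \ D) ∩ N).card : ℚ) ≤ N.card := by
    exact_mod_cast Finset.card_le_card Finset.inter_subset_right
  have h4 : (D.card : ℚ) * ((W \ D) ∩ N).card ≤ D.card * N.card :=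
    mul_le_mul_of_nonneg_left h3 (Nat.cast_nonneg _)
  linarith

/-- Choice of a maximal set `T` of removed separator vertices. -/
lemma exists_T (k : ℕ) (A S : Finset V) : ∃ T ⊆ S, cc H A T ≤ (k : ℚ) * T.card ∧
    ∀ Q ⊆ S \ T, Q.Nonempty → ¬ cc H A Q ≤ (k : ℚ) * Q.card := by
  classical
  obtain ⟨T, hT, hmax⟩ := Finset.exists_max_image
    (S.powerset.filter fun T => cc H A T ≤ (k : ℚ) * T.card) Finset.card
    ⟨∅, by simp [cc]⟩
  simp only [Finset.mem_filter, Finset.mem_powerset] at hT hmax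
  refine ⟨T, hT.1, hT.2, fun Q hQ hne hle => ?_⟩
  have hd : Disjoint T Q := Finset.disjoint_of_subset_right hQ Finset.disjoint_sdiff
  have := hmax (T ∪ Q) ⟨Finset.union_subset hT.1 (hQ.trans Finset.sdiff_subset), by
    rw [cc_union_right _ _ _ _ hd, Finset.card_union_of_disjoint hd]
    push_cast; linarith [hT.2]⟩
  rw [Finset.card_union_of_disjoint hd] at this
  have := hne.card_pos
  omega

lemma cc_AQ_le (k : ℕ) (W1 A A1 S1 B1 : Finset V) (h : IsSep H k W1 A1 S1 B1) (hA : A ⊆ W1)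
    (hy : A ∩ B1 = ∅) : cc H A B1 ≤ (k : ℚ) * B1.card := by
  have e : A = (A ∩ A1) ∪ (A ∩ S1) := by
    ext u
    have := @hA u
    rw [← h.un] at this
    have h2 : u ∉ A ∩ B1 := by simp [hy]
    simp at *; tauto
  have hd : Disjoint (A ∩ A1) (A ∩ S1) :=
    Finset.disjoint_of_subset_left Finset.inter_subset_right
      (Finset.disjoint_of_subset_right Finset.inter_subset_right h.dAS)
  rw [e, cc_union_left _ _ _ _ hd, cc_zero H (A ∩ A1) B1 fun u hu v hv =>
    h.no u (Finset.mem_inter.1 hu).2 v hv, zero_add]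
  refine (cc_le H _ _).trans ?_
  have : ((A ∩ S1).card : ℚ) ≤ k := by
    rw [← h.cS]; exact_mod_cast Finset.card_le_card Finset.inter_subset_right
  exact mul_le_mul_of_nonneg_right this (Nat.cast_nonneg _)

lemma card_split3 (W A X Y Z : Finset V) (hA : A ⊆ X ∪ Y ∪ Z) (h1 : Disjoint X Y)
    (h2 : Disjoint X Z) (h3 : Disjoint Y Z) :
    A.card = (A ∩ X).card + (A ∩ Y).card + (A ∩ Z).card ∧
    ∀ U, cc H U A = cc H U (A ∩ X) + cc H U (A ∩ Y) + cc H U (A ∩ Z) := by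
  have e : A = (A ∩ X ∪ A ∩ Y) ∪ A ∩ Z := by
    rw [← Finset.inter_union_distrib_left, ← Finset.inter_union_distrib_left]
    exact (Finset.inter_eq_left.2 hA).symm
  have d1 : Disjoint (A ∩ X) (A ∩ Y) := h1.mono Finset.inter_subset_right Finset.inter_subset_right
  have d2 : Disjoint (A ∩ X ∪ A ∩ Y) (A ∩ Z) := by
    rw [Finset.disjoint_union_left]
    exact ⟨h2.mono Finset.inter_subset_right Finset.inter_subset_right,
      h3.mono Finset.inter_subset_right Finset.inter_subset_right⟩
  constructor
  · conv_lhs => rw [e]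
    rw [Finset.card_union_of_disjoint d2, Finset.card_union_of_disjoint d1]
  · intro U
    conv_lhs => rw [e]
    rw [cc_union_right _ _ _ _ d2, cc_union_right _ _ _ _ d1]

/-- Deletion inequality for one side of the inner separation. -/
lemma side_bound (k d : ℕ) (W A S B T A1 S1 B1 : Finset V) (h : IsSep H k W A S B)
    (hT : T ⊆ S) (h1 : IsSep H k (A ∪ (S \ T)) A1 S1 B1)
    (hW : W.card = k + d)
    (ih : ∀ W' : Finset V, ∀ d' : ℕ, d' < d → 3 * k ≤ 2 * d' → W'.card = k + d' →
      cc H W' W' ≤ 19 / 6 * (k : ℚ) * d')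
    (hbig : 19 / 6 * (k : ℚ) * d < cc H W W)
    (hx : (A ∩ A1).Nonempty)
    (hdx : 3 * k + 2 * (A ∩ A1).card ≤ 2 * d) :
    7 / 12 * (k : ℚ) < (((A ∩ A1).card : ℚ) - 1) / 2 + (S ∩ A1).card + T.card := by
  set X := A ∩ A1 with hX
  have hpos := hx.card_pos
  have hXW : X ⊆ W := by
    rw [← h.un]
    intro u hu
    simp [hX] at hu ⊢; tauto
  have key := del_bound H W X (S1 ∪ (S ∩ A1) ∪ T) hXW (by
    intro u hu v hv hadj
    simp only [hX, Finset.mem_inter, Finset.mem_sdiff, Finset.mem_union, not_or, not_and] at hu hv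
    obtain ⟨⟨hvW, hvX⟩, ⟨hvS1, hvS⟩, hvT⟩ := hv
    rw [← h.un] at hvW
    have hvB : v ∉ B := fun hh => h.no u hu.1 v hh hadj
    have hvB1 : v ∉ B1 := fun hh => h1.no u hu.2 v hh hadj
    have hm : v ∈ A ∪ (S \ T) := by
      simp at hvW ⊢; tauto
    rw [← h1.un] at hm
    simp at hvW hm
    tauto)
  have hcN : ((S1 ∪ (S ∩ A1) ∪ T).card : ℚ) ≤ k + (S ∩ A1).card + T.card := by
    have := (Finset.card_union_le (S1 ∪ (S ∩ A1)) T)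
    have h2 := (Finset.card_union_le S1 (S ∩ A1))
    rw [h1.cS] at h2
    exact_mod_cast (by omega : (S1 ∪ (S ∩ A1) ∪ T).card ≤ k + (S ∩ A1).card + T.card)
  have hcW : (W \ X).card = k + (d - X.card) := by
    rw [Finset.card_sdiff_of_subset hXW]; omega
  have i := ih (W \ X) (d - X.card) (by omega) (by omega) hcW
  rw [Nat.cast_sub (by omega)] at i
  have hp : (0 : ℚ) < X.card := by exact_mod_cast hpos
  have hm := mul_le_mul_of_nonneg_left hcN hp.le
  have : 0 < (X.card : ℚ) * ((((X.card : ℚ) - 1) / 2 + (S ∩ A1).card + T.card) - 7 / 12 * (k : ℚ)) := by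
    nlinarith
  have := (mul_pos_iff_of_pos_left hp).1 this
  linarith

lemma touch_arith (k x y z α β ρ σ a cT c1 c2 c3 c5 c6 c7 c8 c9 : ℚ)
    (ek : k = α + β + ρ + σ) (ez : z = α + β + σ) (ea : a = x + y + z) (hx : 0 ≤ x) (hy : 0 ≤ y)
    (m1 : y * (7 / 12 * k) ≤ y * ((x - 1) / 2 + α + σ))
    (m2 : x * (7 / 12 * k) ≤ x * ((y - 1) / 2 + β + σ))
    (m3 : 0 ≤ (7 / 12 * k - σ) * ρ) (hT : cT ≤ k * σ)
    (b1 : c1 ≤ (x + z) * α) (b2 : c2 ≤ (y + z) * β) (b3 : c3 ≤ a * ρ)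
    (b5 : c5 ≤ x * (x - 1)) (b6 : c6 ≤ y * (y - 1)) (b7 : c7 ≤ z * (z - 1))
    (b8 : c8 ≤ x * z) (b9 : c9 ≤ y * z) :
    2 * (cT + (c1 + c2 + c3)) + (c5 + c6 + c7 + 2 * c8 + 2 * c9) ≤
      2 * a * k + a * (a - 1) - 7 / 6 * k * (a - k) := by
  subst ea ez ek
  nlinarith

set_option maxHeartbeats 1000000 in
lemma touch_bound (k d : ℕ) (hsep : ∀ W : Finset V, k + 2 ≤ W.card → ∃ A S B, IsSep H k W A S B)
    (W A S B : Finset V) (h : IsSep H k W A S B)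
    (hW : W.card = k + d)
    (ih : ∀ W' : Finset V, ∀ d' : ℕ, d' < d → 3 * k ≤ 2 * d' → W'.card = k + d' →
      cc H W' W' ≤ 19 / 6 * (k : ℚ) * d')
    (hbig : 19 / 6 * (k : ℚ) * d < cc H W W)
    (hd : 2 * k < d) (hab : A.card ≤ B.card) (hka : k < A.card) :
    2 * cc H A S + cc H A A ≤ 2 * (A.card : ℚ) * k + A.card * ((A.card : ℚ) - 1)
      - 7 / 6 * k * ((A.card : ℚ) - k) := by
  have hcard := h.card
  obtain ⟨T, hTS, hT, hTmax⟩ := exists_T H k A S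
  have hsT := Finset.card_sdiff_of_subset hTS
  have hTle := Finset.card_le_card hTS
  rw [h.cS] at hsT hTle
  have hST : cc H A S = cc H A T + cc H A (S \ T) := by
    rw [← cc_union_right _ _ _ _ Finset.disjoint_sdiff, Finset.union_sdiff_of_subset hTS]
  have hTle' : (T.card : ℚ) ≤ k := by exact_mod_cast hTle
  have hka' : (k : ℚ) < A.card := by exact_mod_cast hka
  have hsT' : ((S \ T).card : ℚ) = k - T.card := by rw [hsT, Nat.cast_sub hTle]
  rcases le_or_gt (7 / 12 * (k : ℚ)) T.card with hσ | hσ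
  · have h1 := cc_le H A (S \ T)
    have h2 := cc_self_le H A
    rw [hsT'] at h1
    nlinarith [mul_nonneg (sub_nonneg.2 hka'.le) (sub_nonneg.2 hσ)]
  have hσn : T.card < k := by
    have : (T.card : ℚ) < k := by
      have : (0 : ℚ) ≤ k := by positivity
      linarith
    exact_mod_cast this
  have dAST : Disjoint A (S \ T) := h.dAS.mono_right Finset.sdiff_subset
  obtain ⟨A1, S1, B1, h1⟩ := hsep (A ∪ (S \ T)) (by
    rw [Finset.card_union_of_disjoint dAST]; omega)
  have hne : ∀ A1 B1 : Finset V, IsSep H k (A ∪ (S \ T)) A1 S1 B1 → (A ∩ B1).Nonempty := by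
    intro A1 B1 h1
    by_contra hcon
    rw [Finset.not_nonempty_iff_eq_empty] at hcon
    refine hTmax B1 ?_ h1.nB (cc_AQ_le H k _ A A1 S1 B1 h1 Finset.subset_union_left hcon)
    intro v hv
    have h2 : v ∉ A ∩ B1 := by simp [hcon]
    have h3 : v ∈ A ∪ (S \ T) := by rw [← h1.un]; simp [hv]
    simp at h2 h3 ⊢; tauto
  have hy := hne A1 B1 h1
  have hx := hne B1 A1 h1.symm
  obtain ⟨cA, ccA⟩ := card_split3 H W A A1 B1 S1 (by
    have : A1 ∪ B1 ∪ S1 = A1 ∪ S1 ∪ B1 := by ext; simp; tauto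
    rw [this, h1.un]; exact Finset.subset_union_left) h1.dAB h1.dAS h1.dSB.symm
  obtain ⟨cS, ccS⟩ := card_split3 H W (S \ T) A1 B1 S1 (by
    have : A1 ∪ B1 ∪ S1 = A1 ∪ S1 ∪ B1 := by ext; simp; tauto
    rw [this, h1.un]; exact Finset.subset_union_right) h1.dAB h1.dAS h1.dSB.symm
  have hTd : ∀ v ∈ T, v ∉ A ∪ (S \ T) := by
    intro v hv
    have := Finset.disjoint_right.1 h.dAS (hTS hv)
    simp [hv, this]
  have hPA : ∀ C, C ⊆ A ∪ (S \ T) → S ∩ C = (S \ T) ∩ C := by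
    intro C hC
    ext v
    have := hTd v
    have := @hC v
    simp only [Finset.mem_inter, Finset.mem_sdiff]; tauto
  have hA1 : A1 ⊆ A ∪ (S \ T) := by rw [← h1.un]; intro v hv; simp [hv]
  have hB1 : B1 ⊆ A ∪ (S \ T) := by rw [← h1.un]; intro v hv; simp [hv]
  have hS1 : S1 ⊆ A ∪ (S \ T) := by rw [← h1.un]; intro v hv; simp [hv]
  have cS1 : k = (A ∩ S1).card + ((S \ T) ∩ S1).card := by
    rw [← h1.cS, ← Finset.card_union_of_disjoint
      (dAST.mono Finset.inter_subset_left Finset.inter_subset_left),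
      ← Finset.union_inter_distrib_right, Finset.inter_eq_right.2 hS1]
  have hxp := hx.card_pos
  have hyp := hy.card_pos
  -- deletion inequalities
  have sx := side_bound H k d W A S B T A1 S1 B1 h hTS h1 hW ih hbig hx
  have sy := side_bound H k d W A S B T B1 S1 A1 h hTS h1.symm hW ih hbig hy
  rw [hPA A1 hA1] at sx
  rw [hPA B1 hB1] at sy
  -- bounds on pieces
  have z1 : cc H (A ∩ A1) (A ∩ B1) = 0 := cc_zero H _ _ fun u hu v hv =>
    h1.no u (Finset.mem_inter.1 hu).2 v (Finset.mem_inter.1 hv).2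
  have z2 : cc H (A ∩ A1) ((S \ T) ∩ B1) = 0 := cc_zero H _ _ fun u hu v hv =>
    h1.no u (Finset.mem_inter.1 hu).2 v (Finset.mem_inter.1 hv).2
  have z3 : cc H (A ∩ B1) ((S \ T) ∩ A1) = 0 := cc_zero H _ _ fun u hu v hv =>
    h1.symm.no u (Finset.mem_inter.1 hu).2 v (Finset.mem_inter.1 hv).2
  have b1 : cc H A ((S \ T) ∩ A1) ≤
      (((A ∩ A1).card : ℚ) + (A ∩ S1).card) * ((S \ T) ∩ A1).card := by
    rw [cc_comm, ccA, cc_comm H _ (A ∩ B1), z3]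
    have := cc_le H ((S \ T) ∩ A1) (A ∩ A1)
    have := cc_le H ((S \ T) ∩ A1) (A ∩ S1)
    linarith
  have b2 : cc H A ((S \ T) ∩ B1) ≤
      (((A ∩ B1).card : ℚ) + (A ∩ S1).card) * ((S \ T) ∩ B1).card := by
    rw [cc_comm, ccA, cc_comm H _ (A ∩ A1), z2]
    have := cc_le H ((S \ T) ∩ B1) (A ∩ B1)
    have := cc_le H ((S \ T) ∩ B1) (A ∩ S1)
    linarith
  have b3 := cc_le H A ((S \ T) ∩ S1)
  have b4 : cc H A A = cc H (A ∩ A1) (A ∩ A1) + cc H (A ∩ B1) (A ∩ B1) + cc H (A ∩ S1) (A ∩ S1)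
      + 2 * cc H (A ∩ A1) (A ∩ S1) + 2 * cc H (A ∩ B1) (A ∩ S1) := by
    rw [ccA A, cc_comm H A, cc_comm H A, cc_comm H A, ccA, ccA, ccA, z1, cc_comm H (A ∩ B1) (A ∩ A1),
      z1, cc_comm H (A ∩ S1) (A ∩ A1), cc_comm H (A ∩ S1) (A ∩ B1)]
    ring
  have b5 := cc_self_le H (A ∩ A1)
  have b6 := cc_self_le H (A ∩ B1)
  have b7 := cc_self_le H (A ∩ S1)
  have b8 := cc_le H (A ∩ A1) (A ∩ S1)
  have b9 := cc_le H (A ∩ B1) (A ∩ S1)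
  rw [hST, ccS A, b4]
  generalize (A ∩ A1).card = x at *
  generalize (A ∩ B1).card = y at *
  generalize (A ∩ S1).card = z at *
  generalize ((S \ T) ∩ A1).card = α at *
  generalize ((S \ T) ∩ B1).card = β at *
  generalize ((S \ T) ∩ S1).card = ρ at *
  generalize T.card = σ at *
  generalize A.card = a at *
  generalize B.card = b at *
  have hzz : z = α + β + σ := by omega
  have conv : ∀ x y β : ℕ, 7 / 12 * (k : ℚ) < ((x : ℚ) - 1) / 2 + β + σ →
      7 * k < 6 * x + 12 * β + 12 * σ := by
    intro x y β h
    have : (7 * k : ℚ) < 6 * x + 12 * β + 12 * σ := by linarith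
    exact_mod_cast this
  have hxx : 3 * k + 2 * x ≤ 2 * d ∧ 3 * k + 2 * y ≤ 2 * d := by
    rcases le_total x y with hxy | hxy
    · have g1 : 3 * k + 2 * x ≤ 2 * d := by omega
      have := conv x y α (sx g1)
      omega
    · have g1 : 3 * k + 2 * y ≤ 2 * d := by omega
      have := conv y x β (sy g1)
      omega
  have sx := sx hxx.1
  have sy := sy hxx.2
  have ek : (k : ℚ) = α + β + ρ + σ := by
    have : k = α + β + ρ + σ := by omega
    exact_mod_cast this
  have ez : (z : ℚ) = α + β + σ := by exact_mod_cast hzz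
  have ea : (a : ℚ) = x + y + z := by exact_mod_cast cA
  have m1 := mul_le_mul_of_nonneg_left sx.le (Nat.cast_nonneg (α := ℚ) y)
  have m2 := mul_le_mul_of_nonneg_left sy.le (Nat.cast_nonneg (α := ℚ) x)
  have m3 := mul_nonneg (sub_nonneg.2 hσ.le) (Nat.cast_nonneg (α := ℚ) ρ)
  exact touch_arith _ _ _ _ _ _ _ _ _ _ _ _ _ _ _ _ _ _ ek ez ea (Nat.cast_nonneg x)
    (Nat.cast_nonneg y) m1 m2 m3 hT b1 b2 b3 b5 b6 b7 b8 b9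

theorem bk (k : ℕ) (hk : 1 ≤ k)
    (hsep : ∀ W : Finset V, k + 2 ≤ W.card → ∃ A S B, IsSep H k W A S B) :
    ∀ d : ℕ, 3 * k ≤ 2 * d → ∀ W : Finset V, W.card = k + d →
      cc H W W ≤ 19 / 6 * (k : ℚ) * d := by
  intro d
  induction d using Nat.strong_induction_on with
  | _ d ih =>
  intro hd W hW
  have hk' : (1 : ℚ) ≤ k := by exact_mod_cast hk
  rcases Nat.lt_or_ge (2 * k) d with h2 | h2
  swap
  · have m := matula H k hsep d (by omega) W hW
    have h2' : (d : ℚ) ≤ 2 * k := by exact_mod_cast h2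
    have hd' : 3 * (k : ℚ) ≤ 2 * d := by exact_mod_cast hd
    nlinarith [mul_nonneg (sub_nonneg.2 h2') (sub_nonneg.2 hd')]
  by_contra hbig
  rw [not_le] at hbig
  obtain ⟨A, S, B, h, hab⟩ : ∃ A S B, IsSep H k W A S B ∧ A.card ≤ B.card := by
    obtain ⟨A, S, B, h⟩ := hsep W (by omega)
    rcases le_total A.card B.card with h' | h'
    · exact ⟨A, S, B, h, h'⟩
    · exact ⟨B, S, A, h.symm, h'⟩
  have hc := h.card
  have hA := h.nA.card_pos
  have hB := h.nB.card_pos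
  have cBS : (B ∪ S).card = k + B.card := by
    rw [Finset.card_union_of_disjoint h.dSB.symm, h.cS]; omega
  have cAS : (A ∪ S).card = k + A.card := by
    rw [Finset.card_union_of_disjoint h.dAS, h.cS]; omega
  have e : (d : ℚ) = A.card + B.card := by
    have : d = A.card + B.card := by omega
    rw [this]; push_cast; ring
  have hab' : (A.card : ℚ) ≤ B.card := by exact_mod_cast hab
  have hA' : (1 : ℚ) ≤ A.card := by exact_mod_cast hA
  have h2' : 2 * (k : ℚ) ≤ A.card + B.card := by rw [← e]; exact_mod_cast h2.le
  have heq := h.cc_eq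
  rcases Nat.lt_or_ge (2 * A.card) (3 * k) with ha | ha
  swap
  · have i1 := ih B.card (by omega) (by omega) _ cBS
    have i2 := ih A.card (by omega) (by omega) _ cAS
    rw [cc_union_left _ _ _ _ h.dAS, cc_union_right _ _ _ _ h.dAS,
      cc_union_right _ _ _ _ h.dAS, cc_comm H S A] at i2
    have := cc_nonneg H S S
    rw [e] at hbig
    linarith
  have ha' : 2 * (A.card : ℚ) ≤ 3 * k := by exact_mod_cast ha.le
  have hpsi : (3 * (k : ℚ) ≤ 2 * B.card ∧ cc H (B ∪ S) (B ∪ S) ≤ 19 / 6 * (k : ℚ) * B.card) ∨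
      (2 * (B.card : ℚ) ≤ 3 * k ∧ cc H (B ∪ S) (B ∪ S) ≤
        ((k : ℚ) + B.card) * (k + B.card - 1) - 2 * ((B.card : ℚ) ^ 2 - 1) / 3) := by
    rcases Nat.lt_or_ge (2 * B.card) (3 * k) with hb | hb
    · exact Or.inr ⟨by exact_mod_cast hb.le, matula H k hsep _ hB _ cBS⟩
    · exact Or.inl ⟨by exact_mod_cast hb, ih B.card (by omega) hb _ cBS⟩
  rcases Nat.lt_or_ge k A.card with hka | hka
  · have tb := touch_bound H k d hsep W A S B h hW
      (fun W' d' h1 h2 h3 => ih d' h1 h2 W' h3) hbig h2 hab hka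
    have hka' : (k : ℚ) ≤ A.card := by exact_mod_cast hka.le
    rw [heq, e] at hbig
    generalize (A.card : ℚ) = a at *
    generalize (B.card : ℚ) = b at *
    generalize (k : ℚ) = k at *
    rcases hpsi with ⟨hb, hp⟩ | ⟨hb, hp⟩
    · nlinarith [mul_nonneg (sub_nonneg.2 ha') (sub_nonneg.2 hka')]
    · nlinarith [mul_nonneg (sub_nonneg.2 ha') (sub_nonneg.2 hka'),
        mul_nonneg (sub_nonneg.2 hb) (sub_nonneg.2 (hka'.trans hab')),
        mul_nonneg (sub_nonneg.2 hab') (sub_nonneg.2 hka'),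
        mul_nonneg (sub_nonneg.2 hk') (sub_nonneg.2 hka')]
  · have t1 := cc_le H A S
    have t2 := cc_self_le H A
    rw [h.cS] at t1
    have hka' : (A.card : ℚ) ≤ k := by exact_mod_cast hka
    rw [heq, e] at hbig
    generalize (A.card : ℚ) = a at *
    generalize (B.card : ℚ) = b at *
    generalize (k : ℚ) = k at *
    rcases hpsi with ⟨hb, hp⟩ | ⟨hb, hp⟩
    · nlinarith
    · nlinarith [mul_nonneg (sub_nonneg.2 hb) (sub_nonneg.2 h2'),
        mul_nonneg (sub_nonneg.2 hka') (sub_nonneg.2 h2'),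
        mul_nonneg (sub_nonneg.2 hka') (sub_nonneg.2 hb),
        mul_nonneg (sub_nonneg.2 hka') (zero_le_one.trans hA')]

end BK

section Sat

lemma exists_weaklySaturated {W V : Type*} [Finite V] (F : SimpleGraph W) (a b : W)
    (hab : F.Adj a b) : ∃ G : SimpleGraph V, IsWeaklySaturated F G := by
  classical
  haveI := Fintype.ofFinite V
  obtain ⟨G, hG, hmin⟩ := Finset.exists_min_image
    (Finset.univ.filter fun G : SimpleGraph V => ∃ (m : ℕ) (c : ℕ → SimpleGraph V),
      c 0 = G ∧ c m = ⊤ ∧ ∀ i < m, AddStep F (c i) (c (i + 1)))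
    (fun G => G.edgeSet.ncard) ⟨⊤, by
      simp only [Finset.mem_filter, Finset.mem_univ, true_and]
      exact ⟨0, fun _ => ⊤, rfl, rfl, by simp⟩⟩
  simp only [Finset.mem_filter, Finset.mem_univ, true_and] at hG hmin
  refine ⟨G, ?_, hG⟩
  rintro ⟨f, hf⟩
  obtain ⟨m, c, h0, hm, hstep⟩ := hG
  have he : s(f a, f b) ∈ G.edgeSet := hf a b hab
  have hlt : (G.deleteEdges {s(f a, f b)}).edgeSet.ncard < G.edgeSet.ncard := by
    rw [edgeSet_deleteEdges]
    exact Set.ncard_sdiff_singleton_lt_of_mem he (Set.toFinite _)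
  refine absurd (hmin (G.deleteEdges {s(f a, f b)}) ⟨m + 1,
    fun i => Nat.casesOn i (G.deleteEdges {s(f a, f b)}) c, rfl, hm, ?_⟩) (by omega)
  intro i hi
  cases i with
  | zero =>
    show AddStep F (G.deleteEdges {s(f a, f b)}) (c 0)
    rw [h0]
    refine ⟨s(f a, f b), by simp [edgeSet_deleteEdges], ?_, f, hf, a, b, hab, rfl⟩
    rw [edgeSet_deleteEdges, Set.insert_sdiff_singleton, Set.insert_eq_of_mem he]
  | succ i => exact hstep i (by omega)

variable {V : Type*} [DecidableEq V]

/-- Enlarge a separator to size exactly `k`. -/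
lemma pad_sep (H : SimpleGraph V) (k : ℕ) (W A B : Finset V) (hA : A ⊆ W) (hB : B ⊆ W)
    (hd : Disjoint A B) (nA : A.Nonempty) (nB : B.Nonempty)
    (no : ∀ u ∈ A, ∀ v ∈ B, ¬ H.Adj u v) (hW : k + 2 ≤ W.card)
    (hk : W.card ≤ A.card + B.card + k) : ∃ A S B, IsSep H k W A S B := by
  have h1 := nA.card_pos
  have h2 := nB.card_pos
  obtain ⟨A', hA', cA⟩ := Finset.exists_subset_card_eq
    (s := A) (n := min A.card (W.card - k - 1)) (min_le_left _ _)
  obtain ⟨B', hB', cB⟩ := Finset.exists_subset_card_eq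
    (s := B) (n := W.card - k - A'.card) (by omega)
  have hd' : Disjoint A' B' := hd.mono hA' hB'
  have hsub : A' ∪ B' ⊆ W := Finset.union_subset (hA'.trans hA) (hB'.trans hB)
  refine ⟨A', W \ (A' ∪ B'), B', ?_, ?_, hd', ?_, ?_, ?_, ?_, ?_⟩
  · ext u
    have := @hsub u
    simp only [Finset.mem_union, Finset.mem_sdiff] at *
    tauto
  · exact (Finset.disjoint_sdiff).mono_left Finset.subset_union_left
  · exact (Finset.sdiff_disjoint).mono_right Finset.subset_union_right
  · rw [Finset.card_sdiff_of_subset hsub, Finset.card_union_of_disjoint hd']; omega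
  · rw [← Finset.card_pos]; omega
  · rw [← Finset.card_pos]; omega
  · exact fun u hu v hv => no u (hA' hu) v (hB' hv)

/-- A mixed separation (`j` vertices and one edge) gives a separation of order `j + 1`. -/
lemma mixed_sep (H : SimpleGraph V) (j : ℕ) (W A B : Finset V) (hA : A ⊆ W) (hB : B ⊆ W)
    (hd : Disjoint A B) (u v : V) (hu : u ∈ A) (hv : v ∈ B)
    (no : ∀ p ∈ A, ∀ q ∈ B, H.Adj p q → p = u ∧ q = v) (hW : j + 3 ≤ W.card)
    (hk : W.card ≤ A.card + B.card + j) : ∃ A S B, IsSep H (j + 1) W A S B := by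
  have hpA : 0 < A.card := Finset.card_pos.2 ⟨u, hu⟩
  have hpB : 0 < B.card := Finset.card_pos.2 ⟨v, hv⟩
  rcases Nat.lt_or_ge 1 A.card with h | h
  · have c := Finset.card_erase_of_mem hu
    refine pad_sep H (j + 1) W (A.erase u) B ((Finset.erase_subset _ _).trans hA) hB
      (hd.mono_left (Finset.erase_subset _ _)) (by rw [← Finset.card_pos]; omega) ⟨v, hv⟩ ?_
      (by omega) (by omega)
    intro p hp q hq hadj
    rw [Finset.mem_erase] at hp
    exact hp.1 (no p hp.2 q hq hadj).1
  · have c := Finset.card_erase_of_mem hv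
    refine pad_sep H (j + 1) W A (B.erase v) hA ((Finset.erase_subset _ _).trans hB)
      (hd.mono_right (Finset.erase_subset _ _)) ⟨u, hu⟩ (by rw [← Finset.card_pos]; omega) ?_
      (by omega) (by omega)
    intro p hp q hq hadj
    rw [Finset.mem_erase] at hq
    exact hq.1 (no p hp q hq.2 hadj).2

lemma sep_of_saturated (s t j : ℕ) (G : SimpleGraph (Fin (s + t + j)))
    (hG : IsWeaklySaturated (completeBipartiteGraph (Fin s) (Fin t)) G)
    (W : Finset (Fin (s + t + j))) (hW : j + 3 ≤ W.card) :
    ∃ A S B, IsSep Gᶜ (j + 1) W A S B := by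
  classical
  obtain ⟨-, m, c, h0, hm, hstep⟩ := hG
  by_cases hE : ∃ u ∈ W, ∃ v ∈ W, Gᶜ.Adj u v
  swap
  · push Not at hE
    obtain ⟨A, hA, cA⟩ := Finset.exists_subset_card_eq (s := W) (n := 1) (by omega)
    have c2 := Finset.card_sdiff_of_subset hA
    exact pad_sep _ _ W A (W \ A) hA Finset.sdiff_subset Finset.disjoint_sdiff
      (by rw [← Finset.card_pos]; omega) (by rw [← Finset.card_pos]; omega)
      (fun u hu v hv => hE u (hA hu) v (Finset.sdiff_subset hv)) (by omega) (by omega)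
  have hex : ∃ i, i ≤ m ∧ ∃ u ∈ W, ∃ v ∈ W, Gᶜ.Adj u v ∧ (c i).Adj u v := by
    obtain ⟨u, hu, v, hv, h⟩ := hE
    exact ⟨m, le_rfl, u, hu, v, hv, h, by rw [hm]; exact h.ne⟩
  obtain ⟨him, u, hu, v, hv, huv, hci⟩ := Nat.find_spec hex
  have hmin := fun i => Nat.find_min hex (m := i)
  generalize Nat.find hex = i at *
  cases i with
  | zero => rw [h0] at hci; exact absurd hci ((compl_adj _ _ _).1 huv).2
  | succ i =>
  have hmin' : ∀ p ∈ W, ∀ q ∈ W, Gᶜ.Adj p q → ¬ (c i).Adj p q := by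
    intro p hp q hq h1 h2
    exact hmin i (by omega) ⟨by omega, p, hp, q, hq, h1, h2⟩
  obtain ⟨e, -, hins, f, hf, a, b, hab, hfe⟩ := hstep i (by omega)
  have hedge : ∀ p ∈ W, ∀ q ∈ W, Gᶜ.Adj p q → (c (i + 1)).Adj p q → s(p, q) = e := by
    intro p hp q hq h1 h2
    have : s(p, q) ∈ (c (i + 1)).edgeSet := h2
    rw [hins, Set.mem_insert_iff] at this
    rcases this with h | h
    · exact h
    · exact absurd h (hmin' p hp q hq h1)
  have huve := hedge u hu v hv huv hci
  -- endpoints of the new edge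
  obtain ⟨a, b, hfe⟩ : ∃ (a : Fin s) (b : Fin t), s(f (Sum.inl a), f (Sum.inr b)) = e := by
    rcases a with a | a <;> rcases b with b | b <;> simp at hab
    · exact ⟨a, b, hfe⟩
    · exact ⟨b, a, by rw [← hfe, Sym2.eq_swap]⟩
  have hmem : f (Sum.inl a) ∈ W ∧ f (Sum.inr b) ∈ W := by
    rw [← huve, Sym2.eq_iff] at hfe
    rcases hfe with ⟨h1, h2⟩ | ⟨h1, h2⟩ <;> rw [h1, h2] <;> simp [hu, hv]
  set A0 : Finset (Fin (s + t + j)) := Finset.univ.image fun x : Fin s => f (Sum.inl x) with hA0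
  set B0 : Finset (Fin (s + t + j)) := Finset.univ.image fun x : Fin t => f (Sum.inr x) with hB0
  have cA0 : A0.card = s := by
    have hi : Function.Injective fun x => f (Sum.inl x) :=
      f.injective.comp Sum.inl_injective
    rw [hA0, Finset.card_image_of_injective _ hi]; simp
  have cB0 : B0.card = t := by
    have hi : Function.Injective fun x => f (Sum.inr x) :=
      f.injective.comp Sum.inr_injective
    rw [hB0, Finset.card_image_of_injective _ hi]; simp
  have hd0 : Disjoint A0 B0 := by
    rw [Finset.disjoint_left]
    intro p hp hq
    simp only [hA0, hB0, Finset.mem_image, Finset.mem_univ, true_and] at hp hq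
    obtain ⟨x, rfl⟩ := hp
    obtain ⟨y, hy⟩ := hq
    exact absurd (f.injective hy) (by simp)
  have hcount : W.card ≤ (W ∩ A0).card + (W ∩ B0).card + j := by
    have h1 : (W ∩ A0).card + (W ∩ B0).card = (W ∩ (A0 ∪ B0)).card := by
      rw [Finset.inter_union_distrib_left, Finset.card_union_of_disjoint
        (hd0.mono Finset.inter_subset_right Finset.inter_subset_right)]
    have h2 : W.card = (W ∩ (A0 ∪ B0)).card + (W \ (A0 ∪ B0)).card :=
      (Finset.card_inter_add_card_sdiff _ _).symm
    have h3 : (W \ (A0 ∪ B0)).card ≤ (A0 ∪ B0)ᶜ.card :=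
      Finset.card_le_card fun x hx => by
        rw [Finset.mem_compl]; exact (Finset.mem_sdiff.1 hx).2
    rw [Finset.card_compl, Finset.card_union_of_disjoint hd0, cA0, cB0, Fintype.card_fin] at h3
    omega
  refine mixed_sep Gᶜ j W (W ∩ A0) (W ∩ B0) Finset.inter_subset_left Finset.inter_subset_left
    (hd0.mono Finset.inter_subset_right Finset.inter_subset_right)
    (f (Sum.inl a)) (f (Sum.inr b)) (by simp [hA0, hmem.1]) (by simp [hB0, hmem.2]) ?_ hW hcount
  intro p hp q hq hadj
  rw [Finset.mem_inter] at hp hq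
  obtain ⟨x, rfl⟩ : ∃ x, f (Sum.inl x) = p := by simpa [hA0] using hp.2
  obtain ⟨y, rfl⟩ : ∃ y, f (Sum.inr y) = q := by simpa [hB0] using hq.2
  have := hedge _ hp.1 _ hq.1 hadj (hf _ _ (by simp))
  rw [← hfe, Sym2.eq_iff] at this
  rcases this with h | ⟨h1, h2⟩
  · exact h
  · exact absurd (f.injective h1) (by simp)

lemma edge_count (n : ℕ) (G : SimpleGraph (Fin n)) :
    2 * (G.edgeSet.ncard : ℚ) + cc Gᶜ Finset.univ Finset.univ = 2 * (n.choose 2 : ℚ) := by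
  classical
  have h1 : cc Gᶜ Finset.univ Finset.univ = 2 * (Gᶜ.edgeSet.ncard : ℚ) := by
    have := Gᶜ.sum_degrees_eq_twice_card_edges
    have h2 : Gᶜ.edgeSet.ncard = Gᶜ.edgeFinset.card := by
      rw [← coe_edgeFinset, Set.ncard_coe_finset]
    rw [h2]
    have h3 : ((∑ v, Gᶜ.degree v : ℕ) : ℚ) = 2 * (Gᶜ.edgeFinset.card : ℚ) := by
      rw [this]; push_cast; ring
    rw [← h3]
    unfold cc
    push_cast
    refine Finset.sum_congr rfl fun v _ => ?_
    rw [degree_eq_sum_if_adj]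
    refine Finset.sum_congr rfl fun w _ => ?_
    congr
  have h4 : G.edgeSet.ncard + Gᶜ.edgeSet.ncard = n.choose 2 := by
    rw [← Set.ncard_union_eq (disjoint_edgeSet.2 disjoint_compl_right) (Set.toFinite _)
      (Set.toFinite _), ← edgeSet_sup, sup_compl_eq_top]
    have := card_edgeFinset_top_eq_card_choose_two (V := Fin n)
    rw [Fintype.card_fin] at this
    rw [← this, ← Set.ncard_coe_finset, coe_edgeFinset]
  rw [h1, ← h4]
  push_cast; ring

end Sat

/-- For `2 < s ≤ t` and `3 ≤ j ≤ (2/3)(s+t) − 5/3`,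
`wsat(s+t+j, K_{s,t}) ≥ C(s+t+j,2) − (19/12)(j+1)(s+t−1)`. -/
theorem wsat_Kst_lower_general (s t j : ℕ) (hs : 2 < s) (hst : s ≤ t) (hj : 3 ≤ j)
    (hjub : (j : ℚ) ≤ 2 / 3 * ((s : ℚ) + t) - 5 / 3) :
    (wsat (s + t + j) (completeBipartiteGraph (Fin s) (Fin t)) : ℚ) ≥
      ((s + t + j).choose 2 : ℚ) - 19 / 12 * ((j : ℚ) + 1) * ((s : ℚ) + t - 1) := by
  have hne : {m | ∃ G : SimpleGraph (Fin (s + t + j)),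
      IsWeaklySaturated (completeBipartiteGraph (Fin s) (Fin t)) G ∧
        G.edgeSet.ncard = m}.Nonempty := by
    obtain ⟨G, hG⟩ := exists_weaklySaturated (V := Fin (s + t + j))
      (completeBipartiteGraph (Fin s) (Fin t)) (Sum.inl ⟨0, by omega⟩) (Sum.inr ⟨0, by omega⟩)
      (by simp)
    exact ⟨_, G, hG, rfl⟩
  obtain ⟨G, hG, hcard⟩ := Nat.sInf_mem hne
  have hw : wsat (s + t + j) (completeBipartiteGraph (Fin s) (Fin t)) = G.edgeSet.ncard := by
    rw [hcard]; rfl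
  rw [hw]
  have hub : 3 * (j + 1) ≤ 2 * (s + t - 1) := by
    have : (3 * j + 5 : ℚ) ≤ 2 * (s + t) := by linarith
    have : 3 * j + 5 ≤ 2 * (s + t) := by exact_mod_cast this
    omega
  have key := bk Gᶜ (j + 1) (by omega)
    (fun W hW => sep_of_saturated s t j G hG W (by omega)) (s + t - 1) hub Finset.univ
    (by rw [Finset.card_univ, Fintype.card_fin]; omega)
  have hcount := edge_count _ G
  rw [Nat.cast_sub (by omega)] at key
  push_cast at key
  linarith
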